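/- Suppose the distortion measure d satisfies d(x,y) ≥ 0, max_x min_y d(x,y) = 0, and d is not identically zero; let d̃ = min{ d(x,y) : d(x,y) > 0 } and d_max = max_{x,y} d(x,y). Then for all probability distributions p and q on 𝒳 with ‖p − q‖₁ ≤ d̃/(4 d_max) and every Δ ≥ 0, |R(Δ|p) − R(Δ|q)| ≤ −(7 d_max / d̃) ‖p − q‖₁ log( ‖p − q‖₁ / (|𝒳| |𝒴|) ). -/

import Mathlib

open scoped BigOperators

/-- `p` is a probability distribution on the finite set `X`. -/
def IsDist {X : Type*} [Fintype X] (p : X → ℝ) : Prop :=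
  (∀ x, 0 ≤ p x) ∧ ∑ x, p x = 1

/-- `V` is a conditional probability distribution on `Y` given `X`. -/
def IsCondDist {X Y : Type*} [Fintype Y] (V : X → Y → ℝ) : Prop :=
  ∀ x, IsDist (V x)

/-- Mutual information `I(q,V)` with the convention `0 log 0 = 0`. -/
noncomputable def mutInfo {X Y : Type*} [Fintype X] [Fintype Y]
    (q : X → ℝ) (V : X → Y → ℝ) : ℝ :=
  ∑ x, ∑ y, if q x * V x y = 0 then 0
    else q x * V x y * Real.log (V x y / ∑ x', q x' * V x' y)

/-- The rate-distortion function `R(Δ|q)`. -/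
noncomputable def rateDist {X Y : Type*} [Fintype X] [Fintype Y]
    (d : X → Y → ℝ) (Δ : ℝ) (q : X → ℝ) : ℝ :=
  sInf { r | ∃ V : X → Y → ℝ, IsCondDist V ∧
    (∑ x, ∑ y, q x * V x y * d x y) ≤ Δ ∧ r = mutInfo q V }

/-- Relative entropy `D(q‖P)` (real-valued; convention `0 log 0 = 0`). -/
noncomputable def relEnt {X : Type*} [Fintype X] (q P : X → ℝ) : ℝ :=
  ∑ x, if q x = 0 then 0 else q x * Real.log (q x / P x)

/-- Absolute continuity: `q(x) = 0` whenever `P(x) = 0` (finiteness of `D(q‖P)`). -/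
def AbsCont {X : Type*} (q P : X → ℝ) : Prop := ∀ x, P x = 0 → q x = 0

open Real

lemma negMulLog_sub_le {s t c : ℝ} (hs : 0 ≤ s) (hs1 : s ≤ 1) (ht : 0 ≤ t) (ht1 : t ≤ 1)
    (hc : 0 < c) (hL : 1 ≤ -log c) :
    negMulLog s - negMulLog t ≤ |s - t| * -log c + c := by
  unfold negMulLog
  rcases le_total t s with h | h
  · rw [abs_of_nonneg (sub_nonneg.2 h)]
    rcases h.eq_or_lt with rfl | h'
    · simp only [sub_self, zero_mul, zero_add]
      exact hc.le
    have hu : 0 < s - t := sub_pos.2 h'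
    have hs0 : 0 < s := by linarith
    have h1 : log (s - t) ≤ log s := log_le_log hu (by linarith)
    have h2 : t * log t ≤ t * log s := by
      rcases ht.eq_or_lt with rfl | ht'
      · simp
      · exact mul_le_mul_of_nonneg_left (log_le_log ht' h) ht
    have h3 := log_le_sub_one_of_pos (div_pos hc hu)
    rw [log_div hc.ne' hu.ne'] at h3
    have h4 := mul_le_mul_of_nonneg_left h3 hu.le
    have h5 : (s - t) * (c / (s - t) - 1) = c - (s - t) := by
      field_simp
    nlinarith [mul_le_mul_of_nonneg_left h1 hu.le]
  · rw [abs_of_nonpos (sub_nonpos.2 h)]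
    have key : t * log t - s * log s ≤ t - s := by
      rcases hs.eq_or_lt with rfl | hs'
      · simpa using (mul_nonpos_of_nonneg_of_nonpos ht (log_nonpos ht ht1)).trans ht
      have ht' : 0 < t := by linarith
      have h3 := log_le_sub_one_of_pos (div_pos ht' hs')
      rw [log_div ht'.ne' hs'.ne'] at h3
      have h4 := mul_le_mul_of_nonneg_left h3 hs'.le
      have h5 : s * (t / s - 1) = t - s := by field_simp
      nlinarith [mul_nonpos_of_nonneg_of_nonpos (sub_nonneg.2 h) (log_nonpos ht ht1)]
    nlinarith [mul_le_mul_of_nonneg_left hL (sub_nonneg.2 h)]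

lemma sum_negMulLog_sub_le {ι : Type*} [Fintype ι] {f g : ι → ℝ} {c : ℝ}
    (hf : ∀ i, 0 ≤ f i) (hf1 : ∀ i, f i ≤ 1) (hg : ∀ i, 0 ≤ g i) (hg1 : ∀ i, g i ≤ 1)
    (hc : 0 < c) (hL : 1 ≤ -log c) :
    ∑ i, negMulLog (f i) - ∑ i, negMulLog (g i) ≤
      (∑ i, |f i - g i|) * -log c + Fintype.card ι * c := by
  rw [← Finset.sum_sub_distrib, Finset.sum_mul]
  refine (Finset.sum_le_sum fun i _ =>
    negMulLog_sub_le (hf i) (hf1 i) (hg i) (hg1 i) hc hL).trans_eq ?_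
  simp [Finset.sum_add_distrib]

section

variable {X Y : Type*} [Fintype X] [Fintype Y]

lemma IsDist.le_one {p : X → ℝ} (hp : IsDist p) (x : X) : p x ≤ 1 :=
  hp.2 ▸ Finset.single_le_sum (fun i _ => hp.1 i) (Finset.mem_univ x)

lemma IsDist.joint {p : X → ℝ} {V : X → Y → ℝ} (hp : IsDist p) (hV : IsCondDist V) :
    IsDist fun z : X × Y => p z.1 * V z.1 z.2 := by
  refine ⟨fun z => mul_nonneg (hp.1 _) ((hV _).1 _), ?_⟩
  simp [Fintype.sum_prod_type, ← Finset.mul_sum, (hV _).2, hp.2]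

lemma IsDist.output {p : X → ℝ} {V : X → Y → ℝ} (hp : IsDist p) (hV : IsCondDist V) :
    IsDist fun y => ∑ x, p x * V x y := by
  refine ⟨fun y => Finset.sum_nonneg fun x _ => mul_nonneg (hp.1 _) ((hV _).1 _), ?_⟩
  rw [Finset.sum_comm]
  simp [← Finset.mul_sum, (hV _).2, hp.2]

lemma mutInfo_eq_entropy {p : X → ℝ} {V : X → Y → ℝ} (hp : IsDist p) (hV : IsCondDist V) :
    mutInfo p V = ∑ x, negMulLog (p x) + ∑ y, negMulLog (∑ x, p x * V x y)
      - ∑ z : X × Y, negMulLog (p z.1 * V z.1 z.2) := by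
  have term : ∀ x y, (if p x * V x y = 0 then 0
      else p x * V x y * log (V x y / ∑ x', p x' * V x' y)) =
      negMulLog (p x) * V x y + p x * V x y * -log (∑ x', p x' * V x' y)
        - negMulLog (p x * V x y) := by
    intro x y
    split_ifs with h
    · rw [h, negMulLog_zero]
      rcases mul_eq_zero.1 h with h | h <;> simp [h]
    · obtain ⟨h1, h2⟩ := mul_ne_zero_iff.1 h
      have hw : 0 < ∑ x', p x' * V x' y :=
        (lt_of_le_of_ne (mul_nonneg (hp.1 x) ((hV x).1 y)) (Ne.symm h)).trans_le
          (Finset.single_le_sum (f := fun x' => p x' * V x' y)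
            (fun i _ => mul_nonneg (hp.1 i) ((hV i).1 y)) (Finset.mem_univ x))
      rw [log_div h2 hw.ne']
      simp only [negMulLog]
      rw [log_mul h1 h2]
      ring
  unfold mutInfo
  simp only [term, Finset.sum_sub_distrib, Finset.sum_add_distrib]
  congr 1
  · congr 1
    · simp [← Finset.mul_sum, (hV _).2]
    · rw [Finset.sum_comm]
      refine Finset.sum_congr rfl fun y _ => ?_
      rw [← Finset.sum_mul, negMulLog]
      ring
  · rw [Fintype.sum_prod_type]

lemma neg_card_le_mutInfo {p : X → ℝ} {V : X → Y → ℝ} (hp : IsDist p) (hV : IsCondDist V) :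
    -(Fintype.card (X × Y) : ℝ) ≤ mutInfo p V := by
  have h1 : 0 ≤ ∑ x, negMulLog (p x) :=
    Finset.sum_nonneg fun x _ => negMulLog_nonneg (hp.1 x) (hp.le_one x)
  have h2 : 0 ≤ ∑ y, negMulLog (∑ x, p x * V x y) :=
    Finset.sum_nonneg fun y _ =>
      negMulLog_nonneg ((hp.output hV).1 y) ((hp.output hV).le_one y)
  have h3 : ∑ z : X × Y, negMulLog (p z.1 * V z.1 z.2) ≤ ∑ _z : X × Y, (1 : ℝ) := by
    refine Finset.sum_le_sum fun z _ => ?_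
    have hz := (hp.joint hV).1 z
    have := self_sub_one_le_mul_log hz
    simp only [negMulLog]
    linarith
  rw [mutInfo_eq_entropy hp hV]
  simp only [Finset.sum_const, Finset.card_univ, nsmul_eq_mul, mul_one] at h3
  linarith

lemma mutInfo_sub_le {p q : X → ℝ} {V W : X → Y → ℝ} (hp : IsDist p) (hq : IsDist q)
    (hV : IsCondDist V) (hW : IsCondDist W) {c θ : ℝ} (hc : 0 < c) (hL : 1 ≤ -log c)
    (hθ : ∑ x, ∑ y, |p x * W x y - q x * V x y| ≤ θ) :
    mutInfo p W - mutInfo q V ≤ (∑ x, |p x - q x| + 2 * θ) * -log c +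
      (Fintype.card X + Fintype.card Y + Fintype.card (X × Y)) * c := by
  have h1 := sum_negMulLog_sub_le hp.1 hp.le_one hq.1 hq.le_one hc hL
  have h2 := sum_negMulLog_sub_le (hp.output hW).1 (hp.output hW).le_one
    (hq.output hV).1 (hq.output hV).le_one hc hL
  have h3 := sum_negMulLog_sub_le (hq.joint hV).1 (hq.joint hV).le_one
    (hp.joint hW).1 (hp.joint hW).le_one hc hL
  have h4 : ∑ y, |∑ x, p x * W x y - ∑ x, q x * V x y| ≤ θ := by
    rw [Finset.sum_comm] at hθ
    refine le_trans (Finset.sum_le_sum fun y _ => ?_) hθ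
    rw [← Finset.sum_sub_distrib]
    exact Finset.abs_sum_le_sum_abs _ _
  have h5 : ∑ z : X × Y, |q z.1 * V z.1 z.2 - p z.1 * W z.1 z.2| ≤ θ := by
    rw [Fintype.sum_prod_type]
    simpa only [abs_sub_comm] using hθ
  rw [mutInfo_eq_entropy hp hW, mutInfo_eq_entropy hq hV]
  have hL0 : 0 ≤ -log c := by linarith
  have h6 := mul_le_mul_of_nonneg_right h4 hL0
  have h7 := mul_le_mul_of_nonneg_right h5 hL0
  linarith

lemma sum_mul_sub_sum_mul_le {p q f : X → ℝ} {M : ℝ} (hp : IsDist p) (hq : IsDist q)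
    (hf : ∀ x, 0 ≤ f x) (hfM : ∀ x, f x ≤ M) :
    ∑ x, p x * f x - ∑ x, q x * f x ≤ (∑ x, |p x - q x|) * (M / 2) := by
  have h : ∑ x, p x * f x - ∑ x, q x * f x = ∑ x, (p x - q x) * (f x - M / 2) := by
    simp only [sub_mul, mul_sub, Finset.sum_sub_distrib, ← Finset.sum_mul, hp.2, hq.2]
    ring
  rw [h, Finset.sum_mul]
  refine Finset.sum_le_sum fun x _ => (le_abs_self _).trans ?_
  rw [abs_mul]
  refine mul_le_mul_of_nonneg_left (abs_le.2 ⟨?_, ?_⟩) (abs_nonneg _) <;>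
    linarith [hf x, hfM x]

open Classical in
/-- Given a zero-distortion reproduction `y₀ x` for each `x`, move a fraction `l` of the mass
that `V` puts on letters of nonzero distortion to `y₀`. -/
noncomputable def shiftToZero (d : X → Y → ℝ) (y₀ : X → Y) (l : ℝ) (V : X → Y → ℝ) (x : X)
    (y : Y) : ℝ :=
  V x y - l * (if d x y = 0 then 0 else V x y) +
    if y = y₀ x then l * ∑ y', (if d x y' = 0 then 0 else V x y') else 0

lemma shiftToZero_isCondDist {X Y : Type*} [Fintype Y] {d : X → Y → ℝ} {y₀ : X → Y} {l : ℝ}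
    {V : X → Y → ℝ} (hV : IsCondDist V) (hl : 0 ≤ l) (hl1 : l ≤ 1) :
    IsCondDist (shiftToZero d y₀ l V) := by
  classical
  refine fun x => ⟨fun y => ?_, ?_⟩
  · have h0 := (hV x).1
    refine add_nonneg ?_ ?_
    · split_ifs
      · simpa using h0 y
      · nlinarith [h0 y]
    · split_ifs
      · refine mul_nonneg hl (Finset.sum_nonneg fun y' _ => ?_)
        split_ifs
        exacts [le_rfl, h0 y']
      · exact le_rfl
  · simp only [shiftToZero, Finset.sum_add_distrib, Finset.sum_sub_distrib, ← Finset.mul_sum,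
      Finset.sum_ite_eq', Finset.mem_univ, if_true, (hV x).2]
    ring

lemma shiftToZero_distortion {d : X → Y → ℝ} {y₀ : X → Y} (hy : ∀ x, d x (y₀ x) = 0)
    (l : ℝ) (V : X → Y → ℝ) (p : X → ℝ) :
    ∑ x, ∑ y, p x * shiftToZero d y₀ l V x y * d x y
      = (1 - l) * ∑ x, ∑ y, p x * V x y * d x y := by
  classical
  simp only [Finset.mul_sum]
  refine Finset.sum_congr rfl fun x _ => Finset.sum_congr rfl fun y _ => ?_
  by_cases h : d x y = 0
  · simp [h]
  · have : y ≠ y₀ x := fun e => h (e ▸ hy x)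
    simp only [shiftToZero, h, this, if_false]
    ring

lemma shiftToZero_dist_le {d : X → Y → ℝ} {y₀ : X → Y} (hd : ∀ x y, 0 ≤ d x y) {m : ℝ}
    (hm : ∀ x y, d x y ≠ 0 → m ≤ d x y) {l : ℝ} (hl : 0 ≤ l) {V : X → Y → ℝ}
    (hV : IsCondDist V) {p : X → ℝ} (hp : IsDist p) :
    m * ∑ x, ∑ y, |p x * shiftToZero d y₀ l V x y - p x * V x y|
      ≤ 2 * l * ∑ x, ∑ y, p x * V x y * d x y := by
  classical
  rcases le_or_gt m 0 with hm0 | hm0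
  · refine (mul_nonpos_of_nonpos_of_nonneg hm0 ?_).trans ?_
    · positivity
    · exact mul_nonneg (by positivity) (Finset.sum_nonneg fun x _ => Finset.sum_nonneg fun y _ =>
        mul_nonneg (mul_nonneg (hp.1 x) ((hV x).1 y)) (hd x y))
  set N : X → Y → ℝ := fun x y => if d x y = 0 then 0 else V x y with hN
  have hN0 : ∀ x y, 0 ≤ N x y := fun x y => by
    simp only [hN]
    split_ifs
    exacts [le_rfl, (hV x).1 y]
  have hbound : ∀ x y, m * N x y ≤ V x y * d x y := fun x y => by
    simp only [hN]
    split_ifs with h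
    · simp [h]
    · nlinarith [hm x y h, (hV x).1 y]
  have hrow : ∀ x, ∑ y, |p x * shiftToZero d y₀ l V x y - p x * V x y|
      ≤ 2 * l * p x * ∑ y, N x y := by
    intro x
    have hle : ∀ y, |p x * shiftToZero d y₀ l V x y - p x * V x y|
        ≤ p x * (l * N x y) + if y = y₀ x then p x * (l * ∑ y', N x y') else 0 := by
      intro y
      have h1 : 0 ≤ p x * (l * N x y) := mul_nonneg (hp.1 x) (mul_nonneg hl (hN0 x y))
      have h2 : 0 ≤ p x * (l * ∑ y', N x y') :=
        mul_nonneg (hp.1 x) (mul_nonneg hl (Finset.sum_nonneg fun y' _ => hN0 x y'))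
      have h3 : p x * shiftToZero d y₀ l V x y - p x * V x y = -(p x * (l * N x y)) +
          if y = y₀ x then p x * (l * ∑ y', N x y') else 0 := by
        simp only [shiftToZero, hN, ← mul_ite_zero]
        ring
      rw [h3]
      split_ifs <;> exact abs_le.2 ⟨by linarith, by linarith⟩
    refine (Finset.sum_le_sum fun y _ => hle y).trans_eq ?_
    simp only [Finset.sum_add_distrib, ← Finset.mul_sum, Finset.sum_ite_eq', Finset.mem_univ,
      if_true]
    ring
  rw [Finset.mul_sum, Finset.mul_sum]
  refine Finset.sum_le_sum fun x _ => (mul_le_mul_of_nonneg_left (hrow x) hm0.le).trans ?_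
  have h := Finset.sum_le_sum fun y (_ : y ∈ Finset.univ) => hbound x y
  rw [← Finset.mul_sum] at h
  have h' := mul_le_mul_of_nonneg_left h (mul_nonneg (mul_nonneg zero_le_two hl) (hp.1 x))
  simp only [mul_assoc, ← Finset.mul_sum] at h' ⊢
  linarith

lemma exists_feasible_near {d : X → Y → ℝ} {y₀ : X → Y} (hy : ∀ x, d x (y₀ x) = 0)
    (hd : ∀ x y, 0 ≤ d x y) {m M : ℝ} (hm0 : 0 < m) (hm : ∀ x y, d x y ≠ 0 → m ≤ d x y)
    (hM0 : 0 ≤ M) (hM : ∀ x y, d x y ≤ M) {p q : X → ℝ} (hp : IsDist p) (hq : IsDist q)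
    {V : X → Y → ℝ} (hV : IsCondDist V) {Δ : ℝ} (hΔ : 0 ≤ Δ)
    (hVΔ : ∑ x, ∑ y, q x * V x y * d x y ≤ Δ) :
    ∃ W, IsCondDist W ∧ ∑ x, ∑ y, p x * W x y * d x y ≤ Δ ∧
      ∑ x, ∑ y, |p x * W x y - q x * V x y| ≤ (1 + M / m) * ∑ x, |p x - q x| := by
  set δ := ∑ x, |p x - q x| with hδ
  have hδ0 : 0 ≤ δ := Finset.sum_nonneg fun x _ => abs_nonneg _
  have hshift : ∑ x, ∑ y, |p x * V x y - q x * V x y| = δ := by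
    refine Finset.sum_congr rfl fun x _ => ?_
    simp only [← sub_mul, abs_mul, abs_of_nonneg ((hV x).1 _), ← Finset.mul_sum, (hV x).2,
      mul_one]
  rcases le_or_gt (∑ x, ∑ y, p x * V x y * d x y) Δ with h | h
  · refine ⟨V, hV, h, hshift.trans_le ?_⟩
    nlinarith [div_nonneg hM0 hm0.le]
  set D := ∑ x, ∑ y, p x * V x y * d x y with hD
  have hD0 : 0 < D := hΔ.trans_lt h
  have hDΔ : D - Δ ≤ δ * (M / 2) := by
    have := sum_mul_sub_sum_mul_le (f := fun x => ∑ y, V x y * d x y) (M := M) hp hq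
      (fun x => Finset.sum_nonneg fun y _ => mul_nonneg ((hV x).1 y) (hd x y))
      (fun x => by
        calc ∑ y, V x y * d x y ≤ ∑ y, V x y * M :=
              Finset.sum_le_sum fun y _ => mul_le_mul_of_nonneg_left (hM x y) ((hV x).1 y)
          _ = M := by rw [← Finset.sum_mul, (hV x).2, one_mul])
    simp only [Finset.mul_sum, ← mul_assoc] at this
    linarith
  have hlD : (D - Δ) / D * D = D - Δ := div_mul_cancel₀ _ hD0.ne'
  have hl : 0 ≤ (D - Δ) / D := div_nonneg (by linarith) hD0.le
  have hl1 : (D - Δ) / D ≤ 1 := (div_le_one hD0).2 (by linarith)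
  refine ⟨shiftToZero d y₀ ((D - Δ) / D) V, shiftToZero_isCondDist hV hl hl1, ?_, ?_⟩
  · rw [shiftToZero_distortion hy]
    linarith
  · have h1 := shiftToZero_dist_le (y₀ := y₀) hd hm hl hV hp
    rw [mul_assoc, ← hD, hlD] at h1
    have h2 : ∑ x, ∑ y, |p x * shiftToZero d y₀ ((D - Δ) / D) V x y - p x * V x y|
        ≤ M / m * δ := by
      rw [div_mul_eq_mul_div, le_div_iff₀ hm0]
      linarith
    rw [add_mul, one_mul, ← hshift, add_comm, hshift]
    refine le_trans ?_ (add_le_add h2 hshift.le)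
    simp only [← Finset.sum_add_distrib]
    exact Finset.sum_le_sum fun x _ => Finset.sum_le_sum fun y _ => abs_sub_le _ _ _

lemma rateDist_sub_le {d : X → Y → ℝ} {y₀ : X → Y} (hy : ∀ x, d x (y₀ x) = 0)
    (hd : ∀ x y, 0 ≤ d x y) {m M : ℝ} (hm0 : 0 < m) (hm : ∀ x y, d x y ≠ 0 → m ≤ d x y)
    (hM0 : 0 ≤ M) (hM : ∀ x y, d x y ≤ M) {p q : X → ℝ} (hp : IsDist p) (hq : IsDist q)
    {Δ : ℝ} (hΔ : 0 ≤ Δ) {c : ℝ} (hc : 0 < c) (hL : 1 ≤ -log c) :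
    rateDist d Δ p - rateDist d Δ q ≤
      (∑ x, |p x - q x| + 2 * ((1 + M / m) * ∑ x, |p x - q x|)) * -log c +
      (Fintype.card X + Fintype.card Y + Fintype.card (X × Y)) * c := by
  rw [sub_le_comm]
  refine le_csInf ?_ ?_
  · classical
    refine ⟨_, fun x y => if y = y₀ x then 1 else 0, fun x => ⟨fun y => ?_, ?_⟩, ?_, rfl⟩
    · dsimp only
      split_ifs <;> norm_num
    · simp
    · simpa [hy] using hΔ
  · rintro _ ⟨V, hV, hVΔ, rfl⟩
    obtain ⟨W, hW, hWΔ, hWV⟩ := exists_feasible_near hy hd hm0 hm hM0 hM hp hq hV hΔ hVΔ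
    have h1 : rateDist d Δ p ≤ mutInfo p W := by
      refine csInf_le ⟨-(Fintype.card (X × Y) : ℝ), ?_⟩ ⟨W, hW, hWΔ, rfl⟩
      rintro _ ⟨U, hU, -, rfl⟩
      exact neg_card_le_mutInfo hp hU
    linarith [mutInfo_sub_le hp hq hV hW hc hL hWV]

end

/-- Palaiyanur–Sahai: continuity bound for the rate-distortion function in
the source distribution. -/
theorem rate_distortion_L1_bound
    {X Y : Type*} [Fintype X] [Fintype Y] [Nonempty X] [Nonempty Y]
    (d : X → Y → ℝ) (hd : ∀ x y, 0 ≤ d x y)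
    (hd0 : (⨆ x, ⨅ y, d x y) = 0) (hdne : ∃ x y, d x y ≠ 0)
    (p q : X → ℝ) (hp : IsDist p) (hq : IsDist q)
    (Δ : ℝ) (hΔ : 0 ≤ Δ)
    (h1 : ∑ x, |p x - q x|
      ≤ sInf { t | ∃ x y, d x y = t ∧ 0 < t } / (4 * ⨆ x, ⨆ y, d x y)) :
    |rateDist d Δ p - rateDist d Δ q|
      ≤ -(7 * (⨆ x, ⨆ y, d x y) / sInf { t | ∃ x y, d x y = t ∧ 0 < t }) *
          (∑ x, |p x - q x|) *
          Real.log ((∑ x, |p x - q x|) /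
            ((Fintype.card X : ℝ) * (Fintype.card Y : ℝ))) := by
  classical
  have hm : ∀ x y, d x y ≠ 0 → sInf { t | ∃ x y, d x y = t ∧ 0 < t } ≤ d x y := fun x y h =>
    csInf_le ⟨0, fun t ⟨_, _, _, ht⟩ => ht.le⟩ ⟨x, y, rfl, (hd x y).lt_of_ne' h⟩
  obtain ⟨x₁, y₁, h₁⟩ := hdne
  have hm0 : 0 < sInf { t | ∃ x y, d x y = t ∧ 0 < t } := by
    have hfin : { t | ∃ x y, d x y = t ∧ 0 < t }.Finite :=
      (Set.finite_range fun z : X × Y => d z.1 z.2).subset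
        (by rintro _ ⟨x, y, rfl, -⟩; exact ⟨(x, y), rfl⟩)
    have hne : { t | ∃ x y, d x y = t ∧ 0 < t }.Nonempty :=
      ⟨_, x₁, y₁, rfl, (hd x₁ y₁).lt_of_ne' h₁⟩
    obtain ⟨_, _, _, h⟩ := hne.csInf_mem hfin
    exact h
  have hM : ∀ x y, d x y ≤ ⨆ x, ⨆ y, d x y := fun x y =>
    (le_ciSup (Set.finite_range (d x)).bddAbove y).trans
      (le_ciSup (f := fun x => ⨆ y, d x y) (Set.finite_range _).bddAbove x)
  have hmM := (hm x₁ y₁ h₁).trans (hM x₁ y₁)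
  have hzero : ∀ x, ∃ y, d x y = 0 := by
    intro x
    obtain ⟨y, hy⟩ := exists_eq_ciInf_of_finite (f := d x)
    refine ⟨y, le_antisymm ?_ (hd x y)⟩
    rw [hy, ← hd0]
    exact le_ciSup (f := fun x => ⨅ y, d x y) (Set.finite_range _).bddAbove x
  choose y₀ hy₀ using hzero
  have hcard : 2 ≤ Fintype.card Y :=
    Fintype.one_lt_card_iff.2 ⟨y₁, y₀ x₁, fun h => h₁ (h ▸ hy₀ x₁)⟩
  generalize sInf { t | ∃ x y, d x y = t ∧ 0 < t } = m at *
  generalize (⨆ x, ⨆ y, d x y) = M at *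
  have hM0 : 0 < M := hm0.trans_le hmM
  have hsymm : ∑ x, |q x - p x| = ∑ x, |p x - q x| := by simp only [abs_sub_comm]
  rcases (Finset.sum_nonneg fun x _ => abs_nonneg (p x - q x) :
    0 ≤ ∑ x, |p x - q x|).eq_or_lt with h0 | hδ
  · have hpq : p = q := by
      funext x
      have := (Finset.sum_eq_zero_iff_of_nonneg fun x _ => abs_nonneg (p x - q x)).1 h0.symm x
        (Finset.mem_univ x)
      exact sub_eq_zero.1 (abs_eq_zero.1 this)
    simp [hpq]
  have hb : (2 : ℝ) ≤ Fintype.card Y := by exact_mod_cast hcard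
  have ha : (1 : ℝ) ≤ Fintype.card X := by exact_mod_cast Fintype.card_pos
  have hquarter : ∑ x, |p x - q x| ≤ 1 / 4 := by
    refine h1.trans ?_
    rw [div_le_div_iff₀ (by positivity) (by norm_num)]
    linarith
  have hpq := fun c hc hL => rateDist_sub_le hy₀ hd hm0 hm hM0.le hM hp hq hΔ (c := c) hc hL
  have hqp := fun c hc hL => rateDist_sub_le hy₀ hd hm0 hm hM0.le hM hq hp hΔ (c := c) hc hL
  rw [hsymm] at hqp
  have hr : 1 ≤ M / m := (one_le_div hm0).2 hmM
  rw [mul_div_assoc 7 M m]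
  rw [Fintype.card_prod, Nat.cast_mul] at hpq hqp
  generalize ∑ x, |p x - q x| = δ at *
  generalize (Fintype.card X : ℝ) = a at *
  generalize (Fintype.card Y : ℝ) = b at *
  generalize M / m = r at *
  have hab : 2 ≤ a * b := by nlinarith
  have hc : 0 < δ / (a * b) := by positivity
  have hL : 2 ≤ -log (δ / (a * b)) := by
    have h8 : δ / (a * b) ≤ (2 ^ 3)⁻¹ := by
      rw [div_le_iff₀ (by positivity)]
      linarith
    have := log_le_log hc h8
    rw [log_inv, log_pow] at this
    have := log_two_gt_d9
    norm_num at *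
    linarith
  have hsmall : (a + b + a * b) * (δ / (a * b)) ≤ 3 * δ := by
    have : (a + b + a * b) * (δ / (a * b)) = (a + b + a * b) * δ / (a * b) := by ring
    rw [this, div_le_iff₀ (by positivity)]
    have : a + b + a * b ≤ 3 * (a * b) := by nlinarith
    nlinarith
  have hpq' := hpq _ hc (by linarith)
  have hqp' := hqp _ hc (by linarith)
  generalize log (δ / (a * b)) = L at *
  have h2 : δ * 2 ≤ δ * -L := mul_le_mul_of_nonneg_left hL hδ.le
  have h3 : δ * -L ≤ r * (δ * -L) := le_mul_of_one_le_left (by linarith) hr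
  exact abs_le.2 ⟨by linarith, by linarith⟩
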